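/- The map sending a finite sequence (a₁, …, a_t) of nonnegative integers (with t ≥ 0 allowed to vary) to the integer column vector A^{a₁+1}·D·A^{a₂+1}·D·⋯·A^{a_t+1}·D·(1,0)ᵀ is injective; that is, distinct sequences yield distinct vectors. -/

import Mathlib

open Matrix

/-- The matrix `A = [[1,1],[0,1]]` over the integers. -/
def matA : Matrix (Fin 2) (Fin 2) ℤ := !![1, 1; 0, 1]

/-- The matrix `D = [[1,0],[1,1]]` over the integers. -/
def matD : Matrix (Fin 2) (Fin 2) ℤ := !![1, 0; 1, 1]

theorem matA_pow (n : ℕ) : matA ^ n = !![1, (n : ℤ); 0, 1] := by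
  induction n with
  | zero => simp [Matrix.one_fin_two]
  | succ n ih => rw [pow_succ, ih]; simp [matA, add_comm]

theorem matA_pow_mul_matD_mulVec (a : ℕ) (v : Fin 2 → ℤ) :
    (matA ^ (a + 1) * matD) *ᵥ v = ![v 0 + (a + 1) * (v 0 + v 1), v 0 + v 1] := by
  rw [matA_pow, matD]
  ext i
  fin_cases i <;> simp [Matrix.mulVec, dotProduct, Fin.sum_univ_two]
  ring

theorem word_mulVec_pos_nonneg (l : List ℕ) :
    0 < ((l.map fun a => matA ^ (a + 1) * matD).prod *ᵥ ![(1 : ℤ), 0]) 0 ∧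
      0 ≤ ((l.map fun a => matA ^ (a + 1) * matD).prod *ᵥ ![(1 : ℤ), 0]) 1 := by
  induction l with
  | nil => simp
  | cons a l ih =>
    obtain ⟨hx, hy⟩ := ih
    rw [List.map_cons, List.prod_cons, ← Matrix.mulVec_mulVec, matA_pow_mul_matD_mulVec]
    constructor
    · rw [Matrix.cons_val_zero]
      positivity
    · rw [Matrix.cons_val_one, Matrix.cons_val_zero]
      positivity

theorem word_cons_mulVec_ne (a : ℕ) (l : List ℕ) :
    (((a :: l).map fun a => matA ^ (a + 1) * matD).prod *ᵥ ![(1 : ℤ), 0]) ≠ ![1, 0] := by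
  obtain ⟨hx, hy⟩ := word_mulVec_pos_nonneg l
  rw [List.map_cons, List.prod_cons, ← Matrix.mulVec_mulVec, matA_pow_mul_matD_mulVec]
  intro h
  have h1 := congrFun h 1
  simp only [Matrix.cons_val_one, Matrix.cons_val_zero] at h1
  linarith

/-- The remainder of division by `s`, taken in `(0, s]`, and the quotient are unique. -/
theorem eq_of_add_mul_eq {x x' s b b' : ℤ} (hx : 0 < x) (hxs : x ≤ s) (hx' : 0 < x')
    (hxs' : x' ≤ s) (h : x + b * s = x' + b' * s) : b = b' := by
  rcases lt_trichotomy b b' with hlt | heq | hgt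
  · nlinarith
  · exact heq
  · nlinarith

/-- The map sending a finite sequence `(a₁, …, a_t)` of nonnegative integers to the vector
`A^{a₁+1} D A^{a₂+1} D ⋯ A^{a_t+1} D (1,0)ᵀ` is injective. -/
theorem matrix_word_injective :
    Function.Injective (fun l : List ℕ =>
      (l.map fun a => matA ^ (a + 1) * matD).prod *ᵥ ![(1 : ℤ), 0]) := by
  intro l
  induction l with
  | nil =>
    rintro (_ | ⟨a, l⟩) h
    · rfl
    · exact absurd (by simpa using h.symm) (word_cons_mulVec_ne a l)
  | cons a l ih =>
    rintro (_ | ⟨a', l'⟩) h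
    · exact absurd (by simpa using h) (word_cons_mulVec_ne a l)
    · obtain ⟨hx, hy⟩ := word_mulVec_pos_nonneg l
      obtain ⟨hx', hy'⟩ := word_mulVec_pos_nonneg l'
      have key := @ih l'
      beta_reduce at key
      simp only [List.map_cons, List.prod_cons] at h
      rw [← Matrix.mulVec_mulVec, matA_pow_mul_matD_mulVec, ← Matrix.mulVec_mulVec,
        matA_pow_mul_matD_mulVec] at h
      generalize (l.map fun a => matA ^ (a + 1) * matD).prod *ᵥ ![(1 : ℤ), 0] = v at *
      generalize (l'.map fun a => matA ^ (a + 1) * matD).prod *ᵥ ![(1 : ℤ), 0] = w at *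
      have h0 := congrFun h 0
      have h1 := congrFun h 1
      simp only [Matrix.cons_val_one, Matrix.cons_val_zero] at h0 h1
      rw [← h1] at h0
      have hb := eq_of_add_mul_eq hx (by linarith) hx' (by linarith) h0
      obtain rfl : a = a' := by exact_mod_cast add_right_cancel hb
      have hvw : v = w := by
        ext i
        fin_cases i
        · exact add_right_cancel h0
        · have := add_right_cancel h0
          change v 1 = w 1
          linarith
      rw [key hvw]
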